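/- Let f : V_n → Z_{p^k} be a generalized bent function such that f(x) = f(−x) for all x and the dual f* is also generalized bent. If p ≡ 1 (mod 4) or n is even, then ε_{f*}(0) = ε_f(0); if p ≡ 3 (mod 4) and n is odd, then ε_{f*}(0) = −ε_f(0). -/

import Mathlib

open Finset

/-- `chr m z = ζ_m ^ z`, the additive character sending `z ∈ ℤ/m` to `e^{2πi z/m}`. -/
noncomputable def chr (m : ℕ) (z : ZMod m) : ℂ :=
  Complex.exp (2 * Real.pi * Complex.I * (z.val : ℂ) / (m : ℂ))

/-- The Walsh transform of a generalized p-ary function `f : V_n → ℤ_{p^k}`,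
where `V_n = (ℤ/p)^n` with the usual dot product. -/
noncomputable def walsh (p k n : ℕ) [NeZero p] [NeZero (p ^ k)]
    (f : (Fin n → ZMod p) → ZMod (p ^ k)) (a : Fin n → ZMod p) : ℂ :=
  ∑ x : Fin n → ZMod p, chr (p ^ k) (f x) * chr p (-(∑ i, a i * x i))

/-- `ξ = 1` if `p ≡ 1 (mod 4)` or `n` even, `ξ = √-1` otherwise. -/
noncomputable def xi (p n : ℕ) : ℂ :=
  if p % 4 = 1 ∨ Even n then 1 else Complex.I

lemma aux_coe_two : ((2 : integralClosure ℤ ℂ) : ℂ) = 2 := rfl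

lemma aux_exists_hom : ∃ (A : Type) (_ : CommRing A) (_ : Nontrivial A)
    (_ : (integralClosure ℤ ℂ) →+* A), (2 : A) = 0 := by
  have hne : Ideal.span {(2 : integralClosure ℤ ℂ)} ≠ ⊤ := by
    intro h
    rw [Ideal.span_singleton_eq_top] at h
    obtain ⟨b, hb⟩ := h.exists_right_inv
    have hb2 : (2 : ℂ) * (b : ℂ) = 1 := by
      have := congrArg (fun t : integralClosure ℤ ℂ => (t : ℂ)) hb
      simpa [aux_coe_two] using this
    have hbi : IsIntegral ℤ (b : ℂ) := b.2
    have hq : (b : ℂ) = algebraMap ℚ ℂ (1/2) := by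
      have : (b : ℂ) = 1/2 := by
        field_simp
        linear_combination hb2
      rw [this]; simp
    rw [hq, isIntegral_algebraMap_iff (algebraMap ℚ ℂ).injective] at hbi
    obtain ⟨y, hy⟩ := IsIntegrallyClosed.isIntegral_iff.mp hbi
    have h2 : (2 : ℚ) * (y : ℚ) = 1 := by
      have : (y : ℚ) = 1/2 := by simpa using hy
      rw [this]; norm_num
    have h3 : (2 : ℤ) * y = 1 := by exact_mod_cast h2
    omega
  refine ⟨(integralClosure ℤ ℂ) ⧸ Ideal.span {(2 : integralClosure ℤ ℂ)}, inferInstance,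
    Ideal.Quotient.nontrivial_iff.mpr hne, Ideal.Quotient.mk _, ?_⟩
  have : Ideal.Quotient.mk (Ideal.span {(2 : integralClosure ℤ ℂ)}) 2 = 0 :=
    Ideal.Quotient.eq_zero_iff_mem.mpr (Ideal.mem_span_singleton_self _)
  rwa [map_ofNat] at this

lemma aux_core {V : Type*} [AddCommGroup V] [Fintype V]
    (hV : ∀ x : V, -x = x → x = 0)
    (c : V → integralClosure ℤ ℂ) (hc : ∀ x, c (-x) = c x) (N M : ℕ) (hN : Odd N) (hM : Odd M)
    (w v u P : integralClosure ℤ ℂ)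
    (hc0 : c 0 ^ N = 1) (hw : w ^ N = 1) (hv : v ^ N = 1) (hu : u ^ 4 = 1)
    (hP : P * P = M) (h : 2 * ∑ x, c x = u * P * (w - v)) : False := by
  classical
  obtain ⟨A, _, _, φ, h2⟩ := aux_exists_hom
  have hodd : ∀ m : ℕ, Odd m → (m : A) = 1 := by
    rintro m ⟨j, rfl⟩
    push_cast
    rw [h2]; ring
  have hunit : ∀ z : integralClosure ℤ ℂ, z ^ N = 1 → IsUnit (φ z) := by
    intro z hz
    refine IsUnit.of_pow_eq_one (n := N) ?_ hN.pos.ne'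
    rw [← map_pow, hz, map_one]
  have h1 : (M : integralClosure ℤ ℂ) * (w - v) = 2 * (u ^ 3 * P * ∑ x, c x) := by
    rw [← hP]
    linear_combination (-(u^3 * P)) * h - P * P * (w - v) * hu
  have hwv : φ w = φ v := by
    have := congrArg φ h1
    simp only [map_mul, map_natCast, map_sub, map_ofNat, h2, hodd M hM] at this
    simpa [sub_eq_zero] using this
  have hEq : w = v := by
    by_contra hne
    have hg := (Commute.all w v).geom_sum₂_mul N
    rw [hw, hv, sub_self] at hg
    have hg0 := (mul_eq_zero.mp hg).resolve_right (sub_ne_zero.mpr hne)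
    have := congrArg φ hg0
    simp only [map_sum, map_mul, map_pow, map_zero, hwv] at this
    rw [Finset.sum_congr rfl (g := fun _ => φ v ^ (N - 1))] at this
    · simp only [Finset.sum_const, Finset.card_range, nsmul_eq_mul, hodd N hN, one_mul] at this
      exact ((hunit v hv).pow (N - 1)).ne_zero this
    · intro i hi
      rw [← pow_add]
      congr 1
      have := Finset.mem_range.mp hi
      omega
  have hS : ∑ x, c x = 0 := by
    rw [hEq, sub_self, mul_zero] at h
    exact (mul_eq_zero.mp h).resolve_left two_ne_zero
  have hS' := congrArg φ hS
  rw [map_sum, map_zero, ← Finset.add_sum_erase _ _ (Finset.mem_univ (0 : V))] at hS'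
  have hz : ∑ x ∈ Finset.univ.erase (0 : V), φ (c x) = 0 := by
    refine Finset.sum_involution (fun x _ => -x) ?_ ?_ ?_ ?_
    · intro x _
      rw [hc]
      linear_combination φ (c x) * h2
    · intro x hx _ hh
      exact (Finset.mem_erase.mp hx).1 (hV x hh)
    · intro x hx
      simpa using hx
    · intro x _
      simp
  rw [hz, add_zero] at hS'
  exact (hunit _ hc0).ne_zero hS'

lemma aux_chr_pow (m : ℕ) [NeZero m] (z : ZMod m) : chr m z ^ m = 1 := by
  rw [chr, ← Complex.exp_nat_mul, Complex.exp_eq_one_iff]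
  refine ⟨z.val, ?_⟩
  have : (m : ℂ) ≠ 0 := by exact_mod_cast NeZero.ne m
  push_cast
  field_simp

lemma aux_chr_eq (m : ℕ) [NeZero m] (z : ZMod m) : chr m z = ZMod.stdAddChar z := by
  rw [chr, ZMod.stdAddChar_apply, ZMod.toCircle_apply]

lemma aux_orth (p n : ℕ) [NeZero p] (hp : p.Prime) (x : Fin n → ZMod p) :
    ∑ a : Fin n → ZMod p, chr p (-(∑ i, a i * x i)) = if x = 0 then (p : ℂ) ^ n else 0 := by
  classical
  simp only [aux_chr_eq]
  split_ifs with h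
  · subst h
    simp [ZMod.card]
  · let g : (Fin n → ZMod p) →+ ZMod p :=
      { toFun := fun a => -(∑ i, a i * x i)
        map_zero' := by simp
        map_add' := by
          intro a b
          simp only [Pi.add_apply, add_mul, Finset.sum_add_distrib]
          ring }
    have key := AddChar.sum_eq_zero_of_ne_one
      (ψ := (ZMod.stdAddChar (N := p)).compAddMonoidHom g) ?_
    · simpa [g] using key
    · intro h1
      obtain ⟨i, hi⟩ := Function.ne_iff.mp h
      have := DFunLike.congr_fun h1 (Pi.single i 1)
      have h3 : ZMod.stdAddChar (g (Pi.single i 1)) = ZMod.stdAddChar (0 : ZMod p) := by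
        simpa using this
      have h4 := ZMod.injective_stdAddChar h3
      simp [g, Pi.single_apply] at h4
      exact hi h4

lemma aux_inv (p k n : ℕ) [NeZero p] [NeZero (p ^ k)] (hp : p.Prime)
    (f : (Fin n → ZMod p) → ZMod (p ^ k)) :
    ∑ a, walsh p k n f a = (p : ℂ) ^ n * chr (p ^ k) (f 0) := by
  classical
  simp only [walsh]
  rw [Finset.sum_comm]
  simp only [← Finset.mul_sum, aux_orth p n hp]
  simp [mul_comm]

lemma aux_walsh_neg (p k n : ℕ) [NeZero p] [NeZero (p ^ k)]
    (f : (Fin n → ZMod p) → ZMod (p ^ k)) (hsym : ∀ x, f (-x) = f x) (a : Fin n → ZMod p) :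
    walsh p k n f (-a) = walsh p k n f a := by
  simp only [walsh]
  rw [← Equiv.sum_comp (Equiv.neg _)]
  simp [hsym]

lemma aux_walsh_zero (p k n : ℕ) [NeZero p] [NeZero (p ^ k)]
    (f : (Fin n → ZMod p) → ZMod (p ^ k)) :
    walsh p k n f 0 = ∑ a, chr (p ^ k) (f a) := by
  simp [walsh, aux_chr_eq p]

lemma aux_main (p k n : ℕ) [NeZero p] [NeZero (p ^ k)] (hp : p.Prime) (hodd : Odd p)
    (f fs fss : (Fin n → ZMod p) → ZMod (p ^ k))
    (εf : (Fin n → ZMod p) → ℂ) (x e u : ℂ) (hx : x ≠ 0)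
    (hεf : ∀ a, εf a = 1 ∨ εf a = -1)
    (hWf : ∀ a, walsh p k n f a =
      x * εf a * (Real.sqrt ((p : ℝ) ^ n) : ℂ) * chr (p ^ k) (fs a))
    (hWfs : walsh p k n fs 0 =
      x * e * (Real.sqrt ((p : ℝ) ^ n) : ℂ) * chr (p ^ k) (fss 0))
    (hsym : ∀ x, f (-x) = f x)
    (hu1 : x * e = u) (hu2 : εf 0 = - u * x) (hu : u ^ 4 = 1) : False := by
  classical
  set P : ℂ := (Real.sqrt ((p : ℝ) ^ n) : ℂ) with hPdef
  have hPP : P * P = ((p ^ n : ℕ) : ℂ) := by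
    rw [hPdef, ← Complex.ofReal_mul, Real.mul_self_sqrt (by positivity)]
    push_cast; rfl
  have hp0 : ((p ^ n : ℕ) : ℂ) ≠ 0 := by
    exact_mod_cast (pow_pos hp.pos n).ne'
  have hP0 : P ≠ 0 := by
    intro h
    rw [h, zero_mul] at hPP
    exact hp0 hPP.symm
  have hNodd : Odd (p ^ k) := hodd.pow
  have hεN : ∀ a, εf a ^ (p ^ k) = εf a := by
    intro a
    rcases hεf a with h | h <;> rw [h]
    · simp
    · exact hNodd.neg_one_pow
  have hEv : ∀ a, εf (-a) * chr (p ^ k) (fs (-a)) = εf a * chr (p ^ k) (fs a) := by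
    intro a
    have h := aux_walsh_neg p k n f hsym a
    rw [hWf, hWf] at h
    apply mul_left_cancel₀ (mul_ne_zero hx hP0)
    linear_combination h
  have hεev : ∀ a, εf (-a) = εf a := by
    intro a
    have h := congrArg (fun t => t ^ (p ^ k)) (hEv a)
    simpa [mul_pow, aux_chr_pow, hεN] using h
  have hε0 : ∀ a, εf a ≠ 0 := by
    intro a h
    rcases hεf a with h' | h' <;> rw [h] at h' <;> norm_num at h'
  have hzev : ∀ a, chr (p ^ k) (fs (-a)) = chr (p ^ k) (fs a) := by
    intro a
    have h := hEv a
    rw [hεev] at h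
    exact mul_left_cancel₀ (hε0 a) h
  have hint : ∀ z : ℂ, ∀ m : ℕ, 0 < m → z ^ m = 1 → IsIntegral ℤ z := by
    intro z m hm hz
    refine IsIntegral.of_pow hm ?_
    rw [hz]; exact isIntegral_one
  have hchr : ∀ z : ZMod (p ^ k), IsIntegral ℤ (chr (p ^ k) z) :=
    fun z => hint _ _ hNodd.pos (aux_chr_pow _ z)
  have hPi : IsIntegral ℤ P := by
    refine IsIntegral.of_pow (n := 2) (by norm_num) ?_
    rw [pow_two, hPP]
    have h := isIntegral_algebraMap (R := ℤ) (A := ℂ) (x := ((p ^ n : ℕ) : ℤ))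
    simpa using h
  let c : (Fin n → ZMod p) → ℂ := fun a => if εf a = εf 0 then chr (p ^ k) (fs a) else 0
  have hci : ∀ a, IsIntegral ℤ (c a) := by
    intro a
    simp only [c]
    split_ifs
    · exact hchr _
    · exact isIntegral_zero
  have hc2 : ∀ a, 2 * c a = chr (p ^ k) (fs a) + εf 0 * (εf a * chr (p ^ k) (fs a)) := by
    intro a
    simp only [c]
    rcases hεf a with h | h <;> rcases hεf 0 with h' | h' <;> rw [h, h'] <;> norm_num <;> ring
  have hE1 : ∑ a, chr (p ^ k) (fs a) = u * P * chr (p ^ k) (fss 0) := by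
    rw [← aux_walsh_zero, hWfs, hu1]
  have hE2 : x * ∑ a, εf a * chr (p ^ k) (fs a) = P * chr (p ^ k) (f 0) := by
    have h := aux_inv p k n hp f
    simp only [hWf] at h
    apply mul_left_cancel₀ hP0
    rw [← mul_assoc P P, hPP]
    push_cast
    rw [← h, Finset.mul_sum, Finset.mul_sum]
    refine Finset.sum_congr rfl fun a _ => by ring
  have hsum : 2 * ∑ a, c a = u * P * (chr (p ^ k) (fss 0) - chr (p ^ k) (f 0)) := by
    rw [Finset.mul_sum]
    simp only [hc2]
    rw [Finset.sum_add_distrib, ← Finset.mul_sum, hE1, hu2]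
    linear_combination (-u) * hE2
  refine aux_core (V := Fin n → ZMod p) ?_ (fun a => ⟨c a, hci a⟩) ?_ (p ^ k) (p ^ n) hNodd
    hodd.pow ⟨_, hchr (fss 0)⟩ ⟨_, hchr (f 0)⟩ ⟨u, hint u 4 (by norm_num) hu⟩ ⟨P, hPi⟩
    ?_ ?_ ?_ ?_ ?_ ?_
  · intro y hy
    haveI := Fact.mk hp
    ext i
    have h := congrFun hy i
    rw [Pi.neg_apply, ZMod.neg_eq_self_iff] at h
    rcases h with h | h
    · simp [h]
    · obtain ⟨j, hj⟩ := hodd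
      omega
  · intro a
    apply Subtype.ext
    simp only [c, hεev, hzev]
  · apply Subtype.ext
    simp [c, aux_chr_pow]
  · apply Subtype.ext
    simp [aux_chr_pow]
  · apply Subtype.ext
    simp [aux_chr_pow]
  · apply Subtype.ext
    simpa using hu
  · apply Subtype.ext
    simpa using hPP
  · apply Subtype.ext
    simpa [aux_coe_two] using hsum

theorem stmt_11 (p k n : ℕ) [NeZero p] [NeZero (p ^ k)] (hp : p.Prime) (hodd : Odd p)
    (hk : 1 ≤ k)
    (f fs fss : (Fin n → ZMod p) → ZMod (p ^ k))
    (εf εfs : (Fin n → ZMod p) → ℂ)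
    (hεf : ∀ a, εf a = 1 ∨ εf a = -1) (hεfs : ∀ a, εfs a = 1 ∨ εfs a = -1)
    (hWf : ∀ a, walsh p k n f a =
      xi p n * εf a * (Real.sqrt ((p : ℝ) ^ n) : ℂ) * chr (p ^ k) (fs a))
    (hWfs : ∀ a, walsh p k n fs a =
      xi p n * εfs a * (Real.sqrt ((p : ℝ) ^ n) : ℂ) * chr (p ^ k) (fss a))
    (hsym : ∀ x, f (-x) = f x) :
    ((p % 4 = 1 ∨ Even n) → εfs 0 = εf 0) ∧
    ((p % 4 = 3 ∧ Odd n) → εfs 0 = -εf 0) := by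
  constructor
  · intro h
    have hxi : xi p n = 1 := by simp only [xi, if_pos h]
    by_contra hne
    refine aux_main p k n hp hodd f fs fss εf (xi p n) (εfs 0) (εfs 0) (by rw [hxi]; norm_num)
      hεf hWf (hWfs 0) hsym (by rw [hxi, one_mul]) ?_ ?_
    · rw [hxi]
      rcases hεf 0 with h1 | h1 <;> rcases hεfs 0 with h2 | h2 <;> simp_all
    · rcases hεfs 0 with h2 | h2 <;> rw [h2] <;> norm_num
  · rintro ⟨h, hn⟩
    have hxi : xi p n = Complex.I := by
      simp only [xi]
      rw [if_neg]
      rintro (h1 | h1)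
      · omega
      · exact (Nat.not_even_iff_odd.mpr hn) h1
    by_contra hne
    refine aux_main p k n hp hodd f fs fss εf (xi p n) (εfs 0) (xi p n * εfs 0)
      (by rw [hxi]; exact Complex.I_ne_zero) hεf hWf (hWfs 0) hsym rfl ?_ ?_
    · rw [hxi]
      have h3 : εf 0 = εfs 0 := by
        rcases hεf 0 with h1 | h1 <;> rcases hεfs 0 with h2 | h2 <;> simp_all
      rw [h3]
      linear_combination (εfs 0) * Complex.I_mul_I
    · rw [hxi, mul_pow, Complex.I_pow_four]
      rcases hεfs 0 with h2 | h2 <;> rw [h2] <;> norm_num
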